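/- There exists a constant C‴, depending only on C_A, K_B, M_B, M_α, α and T, such that for all y, w, h, k ∈ E and all t ∈ [t₀,T], ‖η^{t₀,y}(t)(h,k) − η^{t₀,w}(t)(h,k)‖ ≤ C‴ ‖h‖ ‖k‖ ‖y−w‖^α; that is, the second variation y ↦ η^{t₀,y}(t) is α-Hölder continuous from E to the bounded bilinear maps E × E → E, uniformly in t. -/

import Mathlib

open MeasureTheory

/-- Operator spaces are equipped with the Borel σ-algebra of the norm topology. -/
noncomputable instance (priority := 100) {E F : Type*} [NormedAddCommGroup E]
    [NormedSpace ℝ E] [NormedAddCommGroup F] [NormedSpace ℝ F] :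
    MeasurableSpace (E →L[ℝ] F) := borel _

/-- A function `[t₀,T] → E` which is measurable and bounded. -/
def BddMeasOn {E : Type u} [NormedAddCommGroup E] [MeasurableSpace E]
    (f : ℝ → E) (t₀ T : ℝ) : Prop :=
  Measurable (fun t : Set.Icc t₀ T => f t) ∧ ∃ M, ∀ t ∈ Set.Icc t₀ T, ‖f t‖ ≤ M

/-- `Y` is a mild solution on `[t₀,T]` of `dY = AY dt + B(t,Y) dt + dz`. -/
def IsMildSolution {E : Type u} [NormedAddCommGroup E] [NormedSpace ℝ E]
    (S : ℝ → E →L[ℝ] E) (B : ℝ → E → E) (t₀ T : ℝ)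
    (y : E) (z : ℝ → E) (Y : ℝ → E) : Prop :=
  ∀ t ∈ Set.Icc t₀ T,
    Y t = S (t - t₀) y + (∫ s in t₀..t, S (t - s) (B s (Y s))) + z t

/-- `ξ` solves the first variation equation along `Y` on `[t₀,T]`. -/
def IsFirstVariation {E : Type u} [NormedAddCommGroup E] [NormedSpace ℝ E]
    (S : ℝ → E →L[ℝ] E) (DB : ℝ → E → E →L[ℝ] E) (t₀ T : ℝ)
    (Y : ℝ → E) (ξ : ℝ → E →L[ℝ] E) : Prop :=
  ∀ t ∈ Set.Icc t₀ T, ∀ h : E,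
    ξ t h = S (t - t₀) h + ∫ s in t₀..t, S (t - s) (DB s (Y s) (ξ s h))

/-- `η` solves the second variation equation along `Y, ξ` on `[t₀,T]`:
`η(t)(h,k) = ∫ S(t-s) D²B(s,Y(s))(ξ(s)h, ξ(s)k) ds + ∫ S(t-s) DB(s,Y(s))(η(s)(h,k)) ds`. -/
def IsSecondVariation {E : Type u} [NormedAddCommGroup E] [NormedSpace ℝ E]
    (S : ℝ → E →L[ℝ] E) (DB : ℝ → E → E →L[ℝ] E)
    (D2B : ℝ → E → E →L[ℝ] E →L[ℝ] E) (t₀ T : ℝ)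
    (Y : ℝ → E) (ξ : ℝ → E →L[ℝ] E) (η : ℝ → E →L[ℝ] E →L[ℝ] E) : Prop :=
  ∀ t ∈ Set.Icc t₀ T, ∀ h k : E,
    η t h k = (∫ s in t₀..t, S (t - s) (D2B s (Y s) (ξ s h) (ξ s k)))
      + ∫ s in t₀..t, S (t - s) (DB s (Y s) (η s h k))


/-- A standard Borel space all of whose subsets are measurable is countable. -/
theorem countable_of_forall_measurableSet {X : Type*} [MeasurableSpace X] [StandardBorelSpace X]
    (h : ∀ s : Set X, MeasurableSet s) : Countable X := by
  by_contra hX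
  have e : X ≃ᵐ ℝ := PolishSpace.measurableEquivOfNotCountable hX
    (by
      rw [← Cardinal.mk_le_aleph0_iff, not_le, Cardinal.mk_real]
      exact Cardinal.aleph0_lt_continuum)
  have hR : ∀ s : Set ℝ, MeasurableSet s := fun s => by
    rw [← e.measurableSet_preimage]; exact h _
  have hle : Cardinal.mk (Set ℝ) ≤ Cardinal.continuum := by
    obtain ⟨b, hb, hgen⟩ :=
      MeasurableSpace.CountablyGenerated.isCountablyGenerated (α := ℝ)
    have := MeasurableSpace.cardinal_measurableSet_le_continuum
      (hb.le_aleph0.trans Cardinal.aleph0_le_continuum)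
    refine le_trans ?_ this
    refine Cardinal.mk_le_of_injective (f := fun s => ⟨s, ?_⟩) ?_
    · have := hR s
      rw [hgen] at this
      exact this
    · intro s t hst
      simpa using hst
  rw [Cardinal.mk_set, Cardinal.mk_real] at hle
  exact absurd hle (not_le.2 (Cardinal.cantor _))

/-- If `f` is a measurable map on a standard Borel space and every subset of `D` is measurable,
then `D` meets the range of `f` in a countable set. -/
theorem Measurable.countable_of_forall_subset_measurableSet {X F : Type*} [MeasurableSpace X]
    [StandardBorelSpace X] [MeasurableSpace F] {f : X → F} (hf : Measurable f) {D : Set F}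
    (hD : D ⊆ Set.range f) (hsub : ∀ s ⊆ D, MeasurableSet s) : D.Countable := by
  let A : Set X := f ⁻¹' D
  have hA : MeasurableSet A := hf (hsub D subset_rfl)
  have := hA.standardBorel
  rcases D.eq_empty_or_nonempty with rfl | ⟨d₀, hd₀⟩
  · exact Set.countable_empty
  have : Nonempty X := ⟨(hD hd₀).choose⟩
  have hex : ∀ d ∈ D, ∃ x, f x = d := fun d hd => hD hd
  choose! σ hσ using hex
  let r : A → A := fun a => ⟨σ (f a), by
    change f (σ (f a)) ∈ D
    rw [hσ _ a.2]; exact a.2⟩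
  have hr : ∀ V : Set A, MeasurableSet (r ⁻¹' V) := by
    intro V
    have : r ⁻¹' V = (fun a : A => f a) ⁻¹' {d | ∃ a : A, r a ∈ V ∧ f a = d} := by
      ext a
      constructor
      · intro ha
        exact ⟨a, ha, rfl⟩
      · rintro ⟨b, hb, hba⟩
        have hrab : r a = r b := Subtype.ext (congrArg σ hba.symm)
        rw [Set.mem_preimage, hrab]
        exact hb
    rw [this]
    refine (hf.comp measurable_subtype_coe) (hsub _ ?_)
    rintro _ ⟨a, -, rfl⟩
    exact a.2
  have hfix : MeasurableSet {a : A | r a = a} :=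
    measurableSet_eq_fun (fun V _ => hr V) measurable_id
  have := hfix.standardBorel
  have hcount : Countable {a : A | r a = a} := by
    refine countable_of_forall_measurableSet fun V => ?_
    have : V = (fun x : {a : A | r a = a} => (x : A)) ⁻¹' (r ⁻¹' (Subtype.val '' V)) := by
      ext x
      have hx : r x = x := x.2
      rw [Set.mem_preimage, Set.mem_preimage, hx]
      exact (Subtype.val_injective.mem_set_image).symm
    rw [this]
    exact measurable_subtype_coe (hr _)
  have hsurj : D ⊆ Set.range (fun x : {a : A | r a = a} => f x) := by
    intro d hd
    have hfd := hσ d hd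
    refine ⟨⟨⟨σ d, ?_⟩, ?_⟩, hfd⟩
    · change f (σ d) ∈ D
      rwa [hfd]
    · exact Subtype.ext (congrArg σ hfd)
  exact (Set.countable_range _).mono hsurj

/-- **Simpson's theorem**: a Borel measurable map from a standard Borel space to a metric space has
separable range. -/
theorem Measurable.isSeparable_range_of_standardBorel {X F : Type*} [MeasurableSpace X]
    [StandardBorelSpace X] [MetricSpace F] [MeasurableSpace F] [BorelSpace F]
    {f : X → F} (hf : Measurable f) : TopologicalSpace.IsSeparable (Set.range f) := by
  obtain ⟨t, -, htc, ht⟩ := EMetric.subset_countable_closure_of_almost_dense_set (Set.range f) <| by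
    intro ε hε
    obtain ⟨δ, hδ, hδε⟩ := ENNReal.lt_iff_exists_nnreal_btwn.1 hε
    have hδ' : 0 < δ := by exact_mod_cast hδ
    obtain ⟨D, hD⟩ := zorn_subset {N : Set F | N ⊆ Set.range f ∧ Metric.IsSeparated δ N} <| by
      intro c hc hchain
      refine ⟨⋃₀ c, ⟨Set.sUnion_subset fun s hs => (hc hs).1, ?_⟩,
        fun s hs => Set.subset_sUnion_of_mem hs⟩
      exact (Set.pairwise_sUnion hchain.directedOn).2 fun s hs => (hc hs).2
    have hcover := Metric.IsCover.of_maximal_isSeparated hD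
    refine ⟨D, ?_, ?_⟩
    · refine hf.countable_of_forall_subset_measurableSet hD.prop.1 fun s hs => ?_
      refine (Metric.isClosed_of_pairwise_le_dist (ε := δ) hδ' ?_).measurableSet
      intro x hx y hy hxy
      have : (δ : ENNReal) < EDist.edist x y := hD.prop.2 (hs hx) (hs hy) hxy
      rw [edist_nndist] at this
      exact_mod_cast this.le
    · refine (Metric.isCover_iff_subset_iUnion_closedEBall.1 hcover).trans ?_
      exact Set.iUnion₂_mono fun x _ => Metric.closedEBall_subset_closedEBall hδε.le
  exact ⟨t, htc, ht⟩

/-- A Borel measurable map from a standard Borel space to a metric space is strongly measurable. -/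
theorem Measurable.stronglyMeasurable_of_standardBorel {X F : Type*} [MeasurableSpace X]
    [StandardBorelSpace X] [MetricSpace F] [MeasurableSpace F] [BorelSpace F]
    {f : X → F} (hf : Measurable f) : StronglyMeasurable f :=
  stronglyMeasurable_iff_measurable_separable.2 ⟨hf, hf.isSeparable_range_of_standardBorel⟩

section Gronwall

variable {F : Type*} [NormedAddCommGroup F] [NormedSpace ℝ F]

/-- A Grönwall inequality for bounded functions, without measurability assumptions. -/
theorem norm_le_of_norm_le_add_norm_integral {δ : ℝ → F} {g : ℝ → ℝ → F} {t₀ T a b L : ℝ}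
    (hb : 0 ≤ b) (hL : 0 ≤ L)
    (hδ : ∃ M, ∀ t ∈ Set.Icc t₀ T, ‖δ t‖ ≤ M)
    (h : ∀ t ∈ Set.Icc t₀ T, ‖δ t‖ ≤ a + ‖∫ s in t₀..t, g t s‖)
    (hg : ∀ t ∈ Set.Icc t₀ T, ∀ s ∈ Set.Icc t₀ t, ‖g t s‖ ≤ L * ‖δ s‖ + b) :
    ∀ t ∈ Set.Icc t₀ T,
      ‖δ t‖ ≤ 2 * Real.exp ((2 * L + 1) * (T - t₀)) * (a + b * (T - t₀)) := by
  intro t ht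
  obtain ⟨M, hM⟩ := hδ
  set c : ℝ := 2 * L + 1 with hc
  have hc0 : 0 < c := by positivity
  let φ : Set.Icc t₀ T → ℝ := fun s => Real.exp (-(c * (s - t₀))) * ‖δ s‖
  have hφ : BddAbove (Set.range φ) := by
    refine ⟨M, ?_⟩
    rintro _ ⟨s, rfl⟩
    have h1 : Real.exp (-(c * (s - t₀))) ≤ 1 := by
      rw [Real.exp_le_one_iff]
      have : 0 ≤ c * ((s : ℝ) - t₀) := mul_nonneg hc0.le (sub_nonneg.2 s.2.1)
      linarith
    calc φ s ≤ 1 * ‖δ s‖ := mul_le_mul_of_nonneg_right h1 (norm_nonneg _)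
      _ ≤ M := by rw [one_mul]; exact hM s s.2
  set N : ℝ := ⨆ s, φ s with hN
  have hle : ∀ s ∈ Set.Icc t₀ T, ‖δ s‖ ≤ N * Real.exp (c * (s - t₀)) := by
    intro s hs
    have := le_ciSup hφ ⟨s, hs⟩
    calc ‖δ s‖ = (Real.exp (-(c * (s - t₀))) * ‖δ s‖) * Real.exp (c * (s - t₀)) := by
          rw [mul_right_comm, ← Real.exp_add]; simp
      _ ≤ _ := mul_le_mul_of_nonneg_right this (Real.exp_pos _).le
  have hN0 : 0 ≤ N := Real.iSup_nonneg fun s => by positivity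
  have hstep : ∀ s ∈ Set.Icc t₀ T,
      ‖δ s‖ ≤ a + b * (T - t₀) + N / 2 * Real.exp (c * (s - t₀)) := by
    intro s hs
    have hder : ∀ r ∈ Set.uIcc t₀ s,
        HasDerivAt (fun r => L * N / c * Real.exp (c * (r - t₀)) + b * r)
          (L * (N * Real.exp (c * (r - t₀))) + b) r := by
      intro r _
      have h1 : HasDerivAt (fun r => c * (r - t₀)) (c * 1) r :=
        ((hasDerivAt_id r).sub_const t₀).const_mul c
      have h2 := (h1.exp.const_mul (L * N / c)).add ((hasDerivAt_id r).const_mul b)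
      refine h2.congr_deriv ?_
      field_simp
    have hint : IntervalIntegrable (fun r => L * (N * Real.exp (c * (r - t₀))) + b)
        volume t₀ s := by
      apply Continuous.intervalIntegrable
      fun_prop
    have hI := intervalIntegral.integral_eq_sub_of_hasDerivAt hder hint
    have hnorm : ‖∫ r in t₀..s, g s r‖ ≤ ∫ r in t₀..s, (L * (N * Real.exp (c * (r - t₀))) + b) := by
      refine intervalIntegral.norm_integral_le_of_norm_le hs.1 ?_ hint
      refine Filter.Eventually.of_forall fun r hr => ?_
      refine (hg s hs r ⟨hr.1.le, hr.2⟩).trans ?_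
      have := hle r ⟨hr.1.le, hr.2.trans hs.2⟩
      gcongr
    have hfrac : L * N / c ≤ N / 2 := by
      rw [div_le_div_iff₀ hc0 two_pos, hc]
      nlinarith
    have hexp := Real.exp_pos (c * (s - t₀))
    have h1 := mul_le_mul_of_nonneg_right hfrac hexp.le
    have h2 : 0 ≤ L * N / c * Real.exp (c * (t₀ - t₀)) := by positivity
    have h3 : b * (s - t₀) ≤ b * (T - t₀) := by
      have := hs.2
      gcongr
    have := h s hs
    rw [hI] at hnorm
    linarith
  have hab : N ≤ 2 * (a + b * (T - t₀)) := by
    have : Nonempty (Set.Icc t₀ T) := ⟨⟨t, ht⟩⟩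
    by_cases hpos : 0 ≤ a + b * (T - t₀)
    · have hN' : N ≤ a + b * (T - t₀) + N / 2 := by
        refine ciSup_le fun s => ?_
        have hexp : Real.exp (-(c * (s - t₀))) ≤ 1 := by
          rw [Real.exp_le_one_iff]
          have : 0 ≤ c * ((s : ℝ) - t₀) := mul_nonneg hc0.le (sub_nonneg.2 s.2.1)
          linarith
        calc φ s ≤ Real.exp (-(c * (s - t₀))) *
              (a + b * (T - t₀) + N / 2 * Real.exp (c * (s - t₀))) :=
              mul_le_mul_of_nonneg_left (hstep s s.2) (Real.exp_pos _).le
          _ = Real.exp (-(c * (s - t₀))) * (a + b * (T - t₀)) + N / 2 := by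
              rw [mul_add, mul_left_comm, ← Real.exp_add]; simp
          _ ≤ 1 * (a + b * (T - t₀)) + N / 2 := by gcongr
          _ = _ := by ring
      linarith
    · have h0 := h t₀ ⟨le_rfl, ht.1.trans ht.2⟩
      rw [intervalIntegral.integral_same, norm_zero, add_zero] at h0
      have := (norm_nonneg _).trans h0
      have : 0 ≤ b * (T - t₀) := mul_nonneg hb (sub_nonneg.2 (ht.1.trans ht.2))
      exact absurd (by linarith) hpos
  have hmono : Real.exp (c * (t - t₀)) ≤ Real.exp (c * (T - t₀)) := by
    have := ht.2
    gcongr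
  calc ‖δ t‖ ≤ N * Real.exp (c * (t - t₀)) := hle t ht
    _ ≤ 2 * (a + b * (T - t₀)) * Real.exp (c * (T - t₀)) :=
        mul_le_mul hab hmono (Real.exp_pos _).le (hN0.trans hab)
    _ = _ := by ring

variable {S : ℝ → F →L[ℝ] F} {C t₀ T : ℝ}

/-- Uniform bound for a convolution with a bounded family of operators. -/
theorem norm_integral_convolution_le (ht₀ : 0 ≤ t₀) (hS : ∀ t ∈ Set.Icc (0 : ℝ) T, ‖S t‖ ≤ C)
    {v : ℝ → F} {b : ℝ} (hv : ∀ s ∈ Set.Icc t₀ T, ‖v s‖ ≤ b) {t : ℝ} (ht : t ∈ Set.Icc t₀ T) :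
    ‖∫ s in t₀..t, S (t - s) (v s)‖ ≤ C * b * T := by
  have hC : 0 ≤ C :=
    (norm_nonneg _).trans (hS 0 ⟨le_rfl, ht₀.trans (ht.1.trans ht.2)⟩)
  have hb : 0 ≤ b := (norm_nonneg _).trans (hv t ht)
  refine (intervalIntegral.norm_integral_le_of_norm_le_const (C := C * b) ?_).trans ?_
  · intro s hs
    rw [Set.uIoc_of_le ht.1] at hs
    refine (S (t - s)).le_of_opNorm_le_of_le (hS _ ⟨?_, ?_⟩) (hv s ⟨hs.1.le, hs.2.trans ht.2⟩)
    · linarith [hs.2]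
    · linarith [hs.1, ht.2]
  · rw [abs_of_nonneg (sub_nonneg.2 ht.1)]
    refine mul_le_mul_of_nonneg_left ?_ (mul_nonneg hC hb)
    linarith [ht.2]

/-- Grönwall inequality for mild (variation of constants) equations. -/
theorem norm_le_of_norm_le_add_norm_convolution (ht₀ : 0 ≤ t₀)
    (hS : ∀ t ∈ Set.Icc (0 : ℝ) T, ‖S t‖ ≤ C) {δ v : ℝ → F} {a b L : ℝ} (hb : 0 ≤ b) (hL : 0 ≤ L)
    (hδ : ∃ M, ∀ t ∈ Set.Icc t₀ T, ‖δ t‖ ≤ M)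
    (h : ∀ t ∈ Set.Icc t₀ T, ‖δ t‖ ≤ a + ‖∫ s in t₀..t, S (t - s) (v s)‖)
    (hv : ∀ s ∈ Set.Icc t₀ T, ‖v s‖ ≤ L * ‖δ s‖ + b) {t : ℝ} (ht : t ∈ Set.Icc t₀ T) :
    ‖δ t‖ ≤ 2 * Real.exp ((2 * (C * L) + 1) * T) * (a + C * b * T) := by
  have hC : 0 ≤ C :=
    (norm_nonneg _).trans (hS 0 ⟨le_rfl, ht₀.trans (ht.1.trans ht.2)⟩)
  have ha : 0 ≤ a := by
    have := h t₀ ⟨le_rfl, ht.1.trans ht.2⟩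
    rw [intervalIntegral.integral_same, norm_zero, add_zero] at this
    exact (norm_nonneg _).trans this
  refine (norm_le_of_norm_le_add_norm_integral (a := a) (b := C * b) (L := C * L)
    (by positivity) (by positivity) hδ h ?_ t ht).trans ?_
  · intro t ht s hs
    have hSt : ‖S (t - s)‖ ≤ C := hS _ ⟨by linarith [hs.2], by linarith [hs.1, ht.2]⟩
    refine ((S (t - s)).le_of_opNorm_le_of_le hSt (hv s ⟨hs.1, hs.2.trans ht.2⟩)).trans ?_
    rw [mul_add, mul_assoc]
  · have h1 : T - t₀ ≤ T := by linarith
    have h2 : 0 ≤ T - t₀ := by linarith [ht.1, ht.2]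
    gcongr

end Gronwall

theorem BddMeasOn.const {E : Type u} [NormedAddCommGroup E] [MeasurableSpace E] {t₀ T : ℝ} (x : E) :
    BddMeasOn (fun _ => x) t₀ T :=
  ⟨measurable_const, ‖x‖, fun _ _ => le_rfl⟩

/-- Superposition of a bounded measurable map with a bounded measurable path. -/
theorem BddMeasOn.superposition {E F : Type u} [NormedAddCommGroup E] [MeasurableSpace E]
    [NormedAddCommGroup F] [MeasurableSpace F] {t₀ T : ℝ} {f : ℝ → E → F}
    (hf : Measurable fun p : ℝ × E => f p.1 p.2) {M : ℝ} (hM : ∀ t x, ‖f t x‖ ≤ M) {Y : ℝ → E}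
    (hY : BddMeasOn Y t₀ T) : BddMeasOn (fun s => f s (Y s)) t₀ T :=
  ⟨hf.comp (measurable_subtype_coe.prodMk hY.1), M, fun _ _ => hM _ _⟩

theorem BddMeasOn.stronglyMeasurable {E : Type u} [NormedAddCommGroup E] [MeasurableSpace E]
    [BorelSpace E] {t₀ T : ℝ} {v : ℝ → E} (hv : BddMeasOn v t₀ T) :
    StronglyMeasurable fun s : Set.Icc t₀ T => v s := by
  have : StandardBorelSpace (Set.Icc t₀ T) := measurableSet_Icc.standardBorel
  exact hv.1.stronglyMeasurable_of_standardBorel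

section BoundedMeasurable

variable {E F : Type u} [NormedAddCommGroup E] [NormedSpace ℝ E] [MeasurableSpace E] [BorelSpace E]
  [NormedAddCommGroup F] [NormedSpace ℝ F] [MeasurableSpace F] [BorelSpace F] {t₀ T : ℝ}

theorem BddMeasOn.clm_apply {A : ℝ → E →L[ℝ] F} {v : ℝ → E} (hA : BddMeasOn A t₀ T)
    (hv : BddMeasOn v t₀ T) : BddMeasOn (fun s => A s (v s)) t₀ T := by
  obtain ⟨a, ha⟩ := hA.2
  obtain ⟨b, hb⟩ := hv.2
  refine ⟨?_, a * b, fun s hs => (A s).le_of_opNorm_le_of_le (ha s hs) (hb s hs)⟩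
  exact (isBoundedBilinearMap_apply.continuous.comp_stronglyMeasurable
    (hA.stronglyMeasurable.prodMk hv.stronglyMeasurable)).measurable

/-- The integrand of a convolution with a bounded measurable semigroup is integrable. -/
theorem BddMeasOn.intervalIntegrable_convolution {S : ℝ → E →L[ℝ] E} {C : ℝ} (ht₀ : 0 ≤ t₀)
    (hS : ∀ t ∈ Set.Icc (0 : ℝ) T, ‖S t‖ ≤ C) (hSm : Measurable fun p : ℝ × E => S p.1 p.2)
    {v : ℝ → E} (hv : BddMeasOn v t₀ T) {t : ℝ} (ht : t ∈ Set.Icc t₀ T) :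
    IntervalIntegrable (fun s => S (t - s) (v s)) volume t₀ t := by
  obtain ⟨b, hb⟩ := hv.2
  rw [intervalIntegrable_iff_integrableOn_Icc_of_le ht.1]
  have hmeas : AEMeasurable (fun s => S (t - s) (v s)) (volume.restrict (Set.Icc t₀ T)) :=
    aemeasurable_restrict_of_measurable_subtype measurableSet_Icc
      (hSm.comp ((measurable_const.sub measurable_subtype_coe).prodMk hv.1))
  have hstrong : AEStronglyMeasurable (fun s => S (t - s) (v s)) (volume.restrict (Set.Icc t₀ T)) :=
    ⟨hmeas.mk _, hmeas.measurable_mk.stronglyMeasurable_of_standardBorel, hmeas.ae_eq_mk⟩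
  refine Integrable.of_bound
    (hstrong.mono_measure (Measure.restrict_mono (Set.Icc_subset_Icc_right ht.2) le_rfl)) (C * b) ?_
  filter_upwards [ae_restrict_mem measurableSet_Icc] with s hs
  exact (S (t - s)).le_of_opNorm_le_of_le
    (hS _ ⟨by linarith [hs.2], by linarith [hs.1, ht.2]⟩) (hb s ⟨hs.1, hs.2.trans ht.2⟩)

theorem BddMeasOn.integral_convolution_sub {S : ℝ → E →L[ℝ] E} {C : ℝ} (ht₀ : 0 ≤ t₀)
    (hS : ∀ t ∈ Set.Icc (0 : ℝ) T, ‖S t‖ ≤ C) (hSm : Measurable fun p : ℝ × E => S p.1 p.2)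
    {v w : ℝ → E} (hv : BddMeasOn v t₀ T) (hw : BddMeasOn w t₀ T) {t : ℝ}
    (ht : t ∈ Set.Icc t₀ T) :
    (∫ s in t₀..t, S (t - s) (v s)) - (∫ s in t₀..t, S (t - s) (w s)) =
      ∫ s in t₀..t, S (t - s) (v s - w s) := by
  rw [← intervalIntegral.integral_sub (hv.intervalIntegrable_convolution ht₀ hS hSm ht)
    (hw.intervalIntegrable_convolution ht₀ hS hSm ht)]
  simp only [map_sub]

end BoundedMeasurable

section Variations

variable {E F G : Type*} [NormedAddCommGroup E] [NormedSpace ℝ E] [NormedAddCommGroup F]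
  [NormedSpace ℝ F] [NormedAddCommGroup G] [NormedSpace ℝ G]

theorem ContinuousLinearMap.norm_apply_sub_apply_le (A A' : E →L[ℝ] F) (x x' : E) :
    ‖A x - A' x'‖ ≤ ‖A‖ * ‖x - x'‖ + ‖A - A'‖ * ‖x'‖ := by
  have : A x - A' x' = A (x - x') + (A - A') x' := by
    rw [map_sub, sub_apply]; abel
  rw [this]
  exact (norm_add_le _ _).trans (add_le_add (A.le_opNorm _) ((A - A').le_opNorm _))

theorem ContinuousLinearMap.norm_apply_apply_sub_le (A A' : E →L[ℝ] F →L[ℝ] G) (x x' : E)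
    (z z' : F) :
    ‖A x z - A' x' z'‖ ≤
      ‖A‖ * ‖x‖ * ‖z - z'‖ + (‖A‖ * ‖x - x'‖ + ‖A - A'‖ * ‖x'‖) * ‖z'‖ :=
  ((A x).norm_apply_sub_apply_le (A' x') z z').trans
    (add_le_add (mul_le_mul_of_nonneg_right (A.le_opNorm x) (norm_nonneg _))
      (mul_le_mul_of_nonneg_right (A.norm_apply_sub_apply_le A' x x') (norm_nonneg _)))

theorem norm_sub_le_of_hasFDerivAt {f : E → F} {f' : E → E →L[ℝ] F} {K : ℝ}
    (hf : ∀ x, HasFDerivAt f (f' x) x) (hK : ∀ x, ‖f' x‖ ≤ K) (x x' : E) :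
    ‖f x - f x'‖ ≤ K * ‖x - x'‖ :=
  convex_univ.norm_image_sub_le_of_norm_hasFDerivWithin_le
    (fun y _ => (hf y).hasFDerivWithinAt) (fun y _ => hK y) (Set.mem_univ x') (Set.mem_univ x)

end Variations

section Estimates

variable {E : Type u} [NormedAddCommGroup E] [NormedSpace ℝ E]
  [MeasurableSpace E] [BorelSpace E] {S : ℝ → E →L[ℝ] E} {B : ℝ → E → E}
  {DB : ℝ → E → E →L[ℝ] E} {D2B : ℝ → E → E →L[ℝ] E →L[ℝ] E} {t₀ T C K M : ℝ}

/-- Mild solutions depend Lipschitz continuously on the initial datum. -/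
theorem IsMildSolution.norm_sub_le (ht₀ : t₀ ∈ Set.Ico 0 T)
    (hS : ∀ t ∈ Set.Icc (0 : ℝ) T, ‖S t‖ ≤ C) (hSm : Measurable fun p : ℝ × E => S p.1 p.2)
    (hBm : Measurable (Function.uncurry B)) {b : ℝ} (hB : ∀ t x, ‖B t x‖ ≤ b)
    (hK : 0 ≤ K) (hLip : ∀ t x x', ‖B t x - B t x'‖ ≤ K * ‖x - x'‖) {z : ℝ → E} {y w : E}
    {Y W : ℝ → E} (hYb : BddMeasOn Y t₀ T) (hY : IsMildSolution S B t₀ T y z Y)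
    (hWb : BddMeasOn W t₀ T) (hW : IsMildSolution S B t₀ T w z W) {t : ℝ}
    (ht : t ∈ Set.Icc t₀ T) :
    ‖Y t - W t‖ ≤ 2 * Real.exp ((2 * (C * K) + 1) * T) * C * ‖y - w‖ := by
  have key := norm_le_of_norm_le_add_norm_convolution (δ := fun t => Y t - W t)
    (v := fun s => B s (Y s) - B s (W s)) (a := C * ‖y - w‖) (b := 0) (L := K) ht₀.1 hS le_rfl hK
    ?_ ?_ ?_ ht
  · refine key.trans_eq ?_
    ring
  · obtain ⟨a, ha⟩ := hYb.2
    obtain ⟨a', ha'⟩ := hWb.2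
    exact ⟨a + a', fun s hs => (_root_.norm_sub_le _ _).trans (add_le_add (ha s hs) (ha' s hs))⟩
  · intro s hs
    have hconv := (hYb.superposition hBm hB).integral_convolution_sub ht₀.1 hS hSm
      (hWb.superposition hBm hB) hs
    have : Y s - W s = S (s - t₀) (y - w) + ∫ r in t₀..s, S (s - r) (B r (Y r) - B r (W r)) := by
      rw [← hconv, hY s hs, hW s hs, map_sub]
      abel
    rw [this]
    refine (norm_add_le _ _).trans (add_le_add ?_ le_rfl)
    exact (S _).le_of_opNorm_le (hS _ ⟨by linarith [hs.1], by linarith [hs.2, ht₀.1]⟩) _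
  · intro s _
    simpa using hLip s (Y s) (W s)

/-- Uniform bound for the first variation. -/
theorem IsFirstVariation.norm_apply_le (ht₀ : t₀ ∈ Set.Ico 0 T)
    (hS : ∀ t ∈ Set.Icc (0 : ℝ) T, ‖S t‖ ≤ C) (hK : 0 ≤ K) (hDB : ∀ t x, ‖DB t x‖ ≤ K)
    {Y : ℝ → E} {ξ : ℝ → E →L[ℝ] E} (hξb : BddMeasOn ξ t₀ T)
    (hξ : IsFirstVariation S DB t₀ T Y ξ) (h : E) {t : ℝ} (ht : t ∈ Set.Icc t₀ T) :
    ‖ξ t h‖ ≤ 2 * Real.exp ((2 * (C * K) + 1) * T) * C * ‖h‖ := by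
  have key := norm_le_of_norm_le_add_norm_convolution (δ := fun t => ξ t h)
    (v := fun s => DB s (Y s) (ξ s h)) (a := C * ‖h‖) (b := 0) (L := K) ht₀.1 hS le_rfl hK
    (hξb.clm_apply (.const h)).2 ?_ ?_ ht
  · refine key.trans_eq ?_
    ring
  · intro s hs
    rw [hξ s hs h]
    refine (norm_add_le _ _).trans (add_le_add ?_ le_rfl)
    exact (S _).le_of_opNorm_le (hS _ ⟨by linarith [hs.1], by linarith [hs.2, ht₀.1]⟩) _
  · intro s _
    rw [add_zero]
    exact (DB s (Y s)).le_of_opNorm_le (hDB _ _) _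

/-- First variations along two nearby paths are close. -/
theorem IsFirstVariation.norm_sub_apply_le (ht₀ : t₀ ∈ Set.Ico 0 T)
    (hS : ∀ t ∈ Set.Icc (0 : ℝ) T, ‖S t‖ ≤ C) (hSm : Measurable fun p : ℝ × E => S p.1 p.2)
    (hK : 0 ≤ K) (hDBm : Measurable fun p : ℝ × E => DB p.1 p.2) (hDB : ∀ t x, ‖DB t x‖ ≤ K)
    {Y W : ℝ → E} (hYb : BddMeasOn Y t₀ T) (hWb : BddMeasOn W t₀ T) {ρ κ : ℝ} (hρ : 0 ≤ ρ)
    (hYW : ∀ s ∈ Set.Icc t₀ T, ‖DB s (Y s) - DB s (W s)‖ ≤ ρ)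
    {ξ ζ : ℝ → E →L[ℝ] E} (hξb : BddMeasOn ξ t₀ T) (hξ : IsFirstVariation S DB t₀ T Y ξ)
    (hζb : BddMeasOn ζ t₀ T) (hζ : IsFirstVariation S DB t₀ T W ζ) (h : E) (hκ : 0 ≤ κ)
    (hζκ : ∀ s ∈ Set.Icc t₀ T, ‖ζ s h‖ ≤ κ) {t : ℝ} (ht : t ∈ Set.Icc t₀ T) :
    ‖ξ t h - ζ t h‖ ≤ 2 * Real.exp ((2 * (C * K) + 1) * T) * (C * (ρ * κ) * T) := by
  have hξh := hξb.clm_apply (.const h)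
  have hζh := hζb.clm_apply (.const h)
  have key := norm_le_of_norm_le_add_norm_convolution (δ := fun t => ξ t h - ζ t h)
    (v := fun s => DB s (Y s) (ξ s h) - DB s (W s) (ζ s h)) (a := 0) (b := ρ * κ)
    (L := K) ht₀.1 hS (mul_nonneg hρ hκ) hK ?_ ?_ ?_ ht
  · rwa [zero_add] at key
  · obtain ⟨a, ha⟩ := hξh.2
    obtain ⟨a', ha'⟩ := hζh.2
    exact ⟨a + a', fun s hs => (_root_.norm_sub_le _ _).trans (add_le_add (ha s hs) (ha' s hs))⟩
  · intro s hs
    have hconv := ((hYb.superposition hDBm hDB).clm_apply hξh).integral_convolution_sub ht₀.1 hS hSm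
      ((hWb.superposition hDBm hDB).clm_apply hζh) hs
    rw [hξ s hs h, hζ s hs h, add_sub_add_left_eq_sub, hconv, zero_add]
  · intro s hs
    refine ((DB s (Y s)).norm_apply_sub_apply_le _ _ _).trans ?_
    exact add_le_add (mul_le_mul_of_nonneg_right (hDB _ _) (norm_nonneg _))
      (mul_le_mul (hYW s hs) (hζκ s hs) (norm_nonneg _) hρ)

/-- Uniform bound for the second variation. -/
theorem IsSecondVariation.norm_apply_apply_le (ht₀ : t₀ ∈ Set.Ico 0 T)
    (hS : ∀ t ∈ Set.Icc (0 : ℝ) T, ‖S t‖ ≤ C) (hK : 0 ≤ K) (hDB : ∀ t x, ‖DB t x‖ ≤ K)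
    {Y : ℝ → E} {ξ : ℝ → E →L[ℝ] E} {η : ℝ → E →L[ℝ] E →L[ℝ] E}
    (hηb : BddMeasOn η t₀ T) (hη : IsSecondVariation S DB D2B t₀ T Y ξ η) (h k : E) {κ : ℝ}
    (hκ : ∀ s ∈ Set.Icc t₀ T, ‖D2B s (Y s) (ξ s h) (ξ s k)‖ ≤ κ) {t : ℝ}
    (ht : t ∈ Set.Icc t₀ T) :
    ‖η t h k‖ ≤ 2 * Real.exp ((2 * (C * K) + 1) * T) * (C * κ * T) := by
  have key := norm_le_of_norm_le_add_norm_convolution (δ := fun t => η t h k)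
    (v := fun s => DB s (Y s) (η s h k)) (a := C * κ * T) (b := 0) (L := K) ht₀.1 hS le_rfl hK
    ((hηb.clm_apply (.const h)).clm_apply (.const k)).2 ?_ ?_ ht
  · refine key.trans_eq ?_
    ring
  · intro s hs
    rw [hη s hs h k]
    exact (norm_add_le _ _).trans
      (add_le_add (norm_integral_convolution_le ht₀.1 hS hκ hs) le_rfl)
  · intro s _
    rw [add_zero]
    exact (DB s (Y s)).le_of_opNorm_le (hDB _ _) _

/-- Second variations along two nearby pairs of paths are close. -/
theorem IsSecondVariation.norm_sub_apply_apply_le (ht₀ : t₀ ∈ Set.Ico 0 T)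
    (hS : ∀ t ∈ Set.Icc (0 : ℝ) T, ‖S t‖ ≤ C) (hSm : Measurable fun p : ℝ × E => S p.1 p.2)
    (hK : 0 ≤ K) (hDBm : Measurable fun p : ℝ × E => DB p.1 p.2) (hDB : ∀ t x, ‖DB t x‖ ≤ K)
    (hD2Bm : Measurable fun p : ℝ × E => D2B p.1 p.2) (hD2B : ∀ t x, ‖D2B t x‖ ≤ M)
    {Y W : ℝ → E} (hYb : BddMeasOn Y t₀ T) (hWb : BddMeasOn W t₀ T) {ρ κ μ : ℝ} (hρ : 0 ≤ ρ)
    (hYW : ∀ s ∈ Set.Icc t₀ T, ‖DB s (Y s) - DB s (W s)‖ ≤ ρ)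
    {ξ ζ : ℝ → E →L[ℝ] E} (hξb : BddMeasOn ξ t₀ T) (hζb : BddMeasOn ζ t₀ T)
    {η θ : ℝ → E →L[ℝ] E →L[ℝ] E}
    (hηb : BddMeasOn η t₀ T) (hη : IsSecondVariation S DB D2B t₀ T Y ξ η)
    (hθb : BddMeasOn θ t₀ T) (hθ : IsSecondVariation S DB D2B t₀ T W ζ θ) (h k : E) (hκ : 0 ≤ κ)
    (hθκ : ∀ s ∈ Set.Icc t₀ T, ‖θ s h k‖ ≤ κ)
    (hμ : ∀ s ∈ Set.Icc t₀ T,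
      ‖D2B s (Y s) (ξ s h) (ξ s k) - D2B s (W s) (ζ s h) (ζ s k)‖ ≤ μ)
    {t : ℝ} (ht : t ∈ Set.Icc t₀ T) :
    ‖η t h k - θ t h k‖ ≤
      2 * Real.exp ((2 * (C * K) + 1) * T) * (C * μ * T + C * (ρ * κ) * T) := by
  have hηh := (hηb.clm_apply (.const h)).clm_apply (.const k)
  have hθh := (hθb.clm_apply (.const h)).clm_apply (.const k)
  refine norm_le_of_norm_le_add_norm_convolution (δ := fun t => η t h k - θ t h k)
    (v := fun s => DB s (Y s) (η s h k) - DB s (W s) (θ s h k))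
    (L := K) ht₀.1 hS (mul_nonneg hρ hκ) hK ?_ ?_ ?_ ht
  · obtain ⟨a, ha⟩ := hηh.2
    obtain ⟨a', ha'⟩ := hθh.2
    exact ⟨a + a', fun s hs => (_root_.norm_sub_le _ _).trans (add_le_add (ha s hs) (ha' s hs))⟩
  · intro s hs
    have hconv := ((hYb.superposition hDBm hDB).clm_apply hηh).integral_convolution_sub ht₀.1 hS hSm
      ((hWb.superposition hDBm hDB).clm_apply hθh) hs
    have hconv' := (((hYb.superposition hD2Bm hD2B).clm_apply
      (hξb.clm_apply (.const h))).clm_apply (hξb.clm_apply (.const k))).integral_convolution_sub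
      ht₀.1 hS hSm (((hWb.superposition hD2Bm hD2B).clm_apply
      (hζb.clm_apply (.const h))).clm_apply (hζb.clm_apply (.const k))) hs
    rw [hη s hs h k, hθ s hs h k, add_sub_add_comm, hconv, hconv']
    exact (norm_add_le _ _).trans
      (add_le_add (norm_integral_convolution_le ht₀.1 hS hμ hs) le_rfl)
  · intro s hs
    refine ((DB s (Y s)).norm_apply_sub_apply_le _ _ _).trans ?_
    exact add_le_add (mul_le_mul_of_nonneg_right (hDB _ _) (norm_nonneg _))
      (mul_le_mul (hYW s hs) (hθκ s hs) (norm_nonneg _) hρ)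

end Estimates

/-- There is a constant `C‴` depending only on `C_A`, `K_B`, `M_B`,
`M_α`, `α` and `T` with `‖η^{t₀,y}(t)(h,k) − η^{t₀,w}(t)(h,k)‖ ≤ C‴ ‖h‖ ‖k‖ ‖y−w‖^α`:
the second variation `y ↦ η^{t₀,y}(t)` is `α`-Hölder continuous from `E` to the
bounded bilinear maps `E × E → E`, uniformly in `t`. -/
theorem second_variation_holder_in_initial_datum (C_A K_B M_B M_alpha T α : ℝ)
    (hα : α ∈ Set.Ioo (0:ℝ) 1) :
    ∃ C''' : ℝ, ∀ (E : Type u) [NormedAddCommGroup E] [NormedSpace ℝ E] [CompleteSpace E]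
      [MeasurableSpace E] [BorelSpace E],
      ∀ (t₀ : ℝ), 0 < T → t₀ ∈ Set.Ico (0:ℝ) T →
      ∀ S : ℝ → E →L[ℝ] E,
        S 0 = ContinuousLinearMap.id ℝ E →
        (∀ s t : ℝ, 0 ≤ s → 0 ≤ t → s + t ≤ T → (S t).comp (S s) = S (s + t)) →
        (∀ t ∈ Set.Icc (0:ℝ) T, ‖S t‖ ≤ C_A) →
        (Measurable fun p : ℝ × E => S p.1 p.2) →
      ∀ (B : ℝ → E → E) (DB : ℝ → E → E →L[ℝ] E)
        (D2B : ℝ → E → E →L[ℝ] E →L[ℝ] E) (Bsup : ℝ),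
        Measurable (Function.uncurry B) →
        (Measurable fun p : ℝ × E => DB p.1 p.2) →
        (Measurable fun p : ℝ × E => D2B p.1 p.2) →
        (∀ t x, ‖B t x‖ ≤ Bsup) →
        (∀ t x, HasFDerivAt (B t) (DB t x) x) →
        (∀ t x, ‖DB t x‖ ≤ K_B) →
        (∀ t x, HasFDerivAt (fun w => DB t w) (D2B t x) x) →
        (∀ t x, ‖D2B t x‖ ≤ M_B) →
        (∀ t x x', ‖D2B t x - D2B t x'‖ ≤ M_alpha * ‖x - x'‖ ^ α) →
      ∀ z : ℝ → E, BddMeasOn z t₀ T →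
      ∀ (Y : E → ℝ → E) (ξ : E → ℝ → E →L[ℝ] E)
        (η : E → ℝ → E →L[ℝ] E →L[ℝ] E),
        (∀ y : E, BddMeasOn (Y y) t₀ T ∧ IsMildSolution S B t₀ T y z (Y y)) →
        (∀ y : E, BddMeasOn (ξ y) t₀ T ∧ IsFirstVariation S DB t₀ T (Y y) (ξ y)) →
        (∀ y : E, BddMeasOn (η y) t₀ T ∧
          IsSecondVariation S DB D2B t₀ T (Y y) (ξ y) (η y)) →
        ∀ (y w h k : E), ∀ t ∈ Set.Icc t₀ T,
          ‖η y t h k - η w t h k‖ ≤ C''' * ‖h‖ * ‖k‖ * ‖y - w‖ ^ α := by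
  let G : ℝ := 2 * Real.exp ((2 * (C_A * K_B) + 1) * T)
  let C₁ : ℝ := G * C_A
  let C₂ : ℝ := G * (C_A * (M_B * C₁ * C₁) * T)
  let C₃ : ℝ := M_B * C₁ * C₂ + (M_B * C₂ + |M_alpha| * C₁ ^ α * C₁) * C₁
  refine ⟨2 * C₂ + G * (C_A * C₃ * T + C_A * (M_B * C₁ * C₂) * T), ?_⟩
  intro E _ _ _ _ _ t₀ hT ht₀ S _ _ hS hSm B DB D2B Bsup hBm hDBm hD2Bm hB hBd hDB hDBd hD2B hHol z _
    Y ξ η hY hξ hη y w h k t ht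
  have hC : 0 ≤ C_A := (norm_nonneg _).trans (hS 0 ⟨le_rfl, hT.le⟩)
  have hK : 0 ≤ K_B := (norm_nonneg _).trans (hDB 0 0)
  have hM : 0 ≤ M_B := (norm_nonneg (D2B 0 0)).trans (hD2B 0 0)
  have hG : 0 ≤ G := by positivity
  have hC₁ : 0 ≤ C₁ := by positivity
  have hC₂ : 0 ≤ C₂ := by positivity
  have hC₃ : 0 ≤ C₃ := by positivity
  have hξle : ∀ (y h : E), ∀ s ∈ Set.Icc t₀ T, ‖ξ y s h‖ ≤ C₁ * ‖h‖ := fun y h s hs =>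
    (hξ y).2.norm_apply_le ht₀ hS hK hDB (hξ y).1 h hs
  have hηle : ∀ y : E, ∀ s ∈ Set.Icc t₀ T, ‖η y s h k‖ ≤ C₂ * (‖h‖ * ‖k‖) := by
    intro y s hs
    refine ((hη y).2.norm_apply_apply_le (κ := M_B * (C₁ * ‖h‖) * (C₁ * ‖k‖))
      ht₀ hS hK hDB (hη y).1 h k ?_ hs).trans_eq (by ring)
    intro r hr
    exact (D2B r (Y y r)).le_of_opNorm₂_le_of_le (hD2B _ _) (hξle y h r hr) (hξle y k r hr)
  have hhk : 0 ≤ ‖h‖ * ‖k‖ := by positivity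
  rcases le_total 1 ‖y - w‖ with hyw | hyw
  · have hpow : 1 ≤ ‖y - w‖ ^ α := Real.one_le_rpow hyw hα.1.le
    calc ‖η y t h k - η w t h k‖ ≤ C₂ * (‖h‖ * ‖k‖) + C₂ * (‖h‖ * ‖k‖) :=
          (norm_sub_le _ _).trans (add_le_add (hηle y t ht) (hηle w t ht))
      _ = 2 * C₂ * (‖h‖ * ‖k‖) * 1 := by ring
      _ ≤ (2 * C₂ + G * (C_A * C₃ * T + C_A * (M_B * C₁ * C₂) * T)) * (‖h‖ * ‖k‖) *
          ‖y - w‖ ^ α := by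
          gcongr
          exact le_add_of_nonneg_right (by positivity)
      _ = _ := by ring
  · set r : ℝ := ‖y - w‖ with hr
    have hr0 : 0 ≤ r := norm_nonneg _
    have hpow : r ≤ r ^ α := Real.self_le_rpow_of_le_one hr0 hyw hα.2.le
    have hpow0 : 0 ≤ r ^ α := hr0.trans hpow
    have hYle : ∀ s ∈ Set.Icc t₀ T, ‖Y y s - Y w s‖ ≤ C₁ * r := fun s hs =>
      (hY y).2.norm_sub_le ht₀ hS hSm hBm hB hK
        (fun t => norm_sub_le_of_hasFDerivAt (hBd t) (hDB t)) (hY y).1 (hY w).1 (hY w).2 hs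
    have hDBle : ∀ s ∈ Set.Icc t₀ T, ‖DB s (Y y s) - DB s (Y w s)‖ ≤ M_B * (C₁ * r) := fun s hs =>
      (norm_sub_le_of_hasFDerivAt (hDBd s) (hD2B s) _ _).trans
        (mul_le_mul_of_nonneg_left (hYle s hs) hM)
    have hξsub : ∀ h : E, ∀ s ∈ Set.Icc t₀ T, ‖ξ y s h - ξ w s h‖ ≤ C₂ * r * ‖h‖ := fun h s hs =>
      ((hξ y).2.norm_sub_apply_le ht₀ hS hSm hK hDBm hDB (hY y).1 (hY w).1 (by positivity) hDBle
        (hξ y).1 (hξ w).1 (hξ w).2 h (by positivity) (hξle w h) hs).trans_eq (by ring)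
    have hD2Ble : ∀ s ∈ Set.Icc t₀ T,
        ‖D2B s (Y y s) - D2B s (Y w s)‖ ≤ |M_alpha| * (C₁ ^ α * r ^ α) := by
      intro s hs
      refine (hHol s _ _).trans ?_
      rw [← Real.mul_rpow hC₁ hr0]
      exact mul_le_mul (le_abs_self _)
        (Real.rpow_le_rpow (norm_nonneg _) (hYle s hs) hα.1.le) (by positivity) (abs_nonneg _)
    have hsource : ∀ s ∈ Set.Icc t₀ T, ‖D2B s (Y y s) (ξ y s h) (ξ y s k) -
        D2B s (Y w s) (ξ w s h) (ξ w s k)‖ ≤ C₃ * (‖h‖ * ‖k‖) * r ^ α := by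
      intro s hs
      refine (ContinuousLinearMap.norm_apply_apply_sub_le _ _ _ _ _ _).trans ?_
      calc _ ≤ M_B * (C₁ * ‖h‖) * (C₂ * r ^ α * ‖k‖) + (M_B * (C₂ * r ^ α * ‖h‖) +
            |M_alpha| * (C₁ ^ α * r ^ α) * (C₁ * ‖h‖)) * (C₁ * ‖k‖) := by
            have hsub : ∀ h : E, ‖ξ y s h - ξ w s h‖ ≤ C₂ * r ^ α * ‖h‖ := fun h =>
              (hξsub h s hs).trans (by gcongr)
            gcongr
            · exact hD2B _ _
            · exact hξle y h s hs
            · exact hsub k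
            · exact hD2B _ _
            · exact hsub h
            · exact hD2Ble s hs
            · exact hξle w h s hs
            · exact hξle w k s hs
        _ = _ := by ring
    have hρ : ∀ s ∈ Set.Icc t₀ T, ‖DB s (Y y s) - DB s (Y w s)‖ ≤ M_B * (C₁ * r ^ α) := fun s hs =>
      (hDBle s hs).trans (by gcongr)
    have key := (hη y).2.norm_sub_apply_apply_le ht₀ hS hSm hK hDBm hDB hD2Bm hD2B (hY y).1 (hY w).1
      (by positivity) hρ (hξ y).1 (hξ w).1 (hη y).1 (hη w).1 (hη w).2 h k (by positivity)
      (hηle w) hsource ht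
    refine key.trans ?_
    calc _ = G * (C_A * C₃ * T + C_A * (M_B * C₁ * C₂) * T) * (‖h‖ * ‖k‖) * r ^ α := by ring
      _ ≤ (2 * C₂ + G * (C_A * C₃ * T + C_A * (M_B * C₁ * C₂) * T)) * (‖h‖ * ‖k‖) * r ^ α := by
          gcongr
          exact le_add_of_nonneg_left (by positivity)
      _ = _ := by ring
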